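/- Let Z_1,…,Z_N be real numbers, let (B_1,…,B_K) be a partition of [N] into K blocks of equal size N/K, and for m ∈ R let ℓ_m(i) = (Z_i − m)². Then for all m, m' ∈ R, the set of medians of the vector of block averages ((K/N)∑_{i∈B_k}(ℓ_{m'}(i) − ℓ_m(i)))_{k∈[K]} equals the set {(m' − M)² − (m − M)² : M ∈ 𝒬_{1/2}((P_{B_k}Z)_{k∈[K]})}, where P_{B_k}Z = (K/N)∑_{i∈B_k}Z_i. In particular, with ℓ_N(m) = (m − MOM_K(Z))² for any fixed median-of-means MOM_K(Z) ∈ 𝒬_{1/2}((P_{B_k}Z)_k), the median-of-means test T_N(m,m') = MOM_K((Z−m')² − (Z−m)²) decomposes as T_N(m,m') = ℓ_N(m') − ℓ_N(m). -/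

import Mathlib

open Finset

/-- The set of medians of a vector `z ∈ ℝ^K`:
`𝒬_{1/2}(z) = {x : #{k : z k ≤ x} ≥ K/2 and #{k : z k ≥ x} ≥ K/2}`. -/
def medianSet {K : ℕ} (z : Fin K → ℝ) : Set ℝ :=
  {x : ℝ | (K : ℝ) / 2 ≤ ((univ.filter fun k => z k ≤ x).card : ℝ) ∧
    (K : ℝ) / 2 ≤ ((univ.filter fun k => x ≤ z k).card : ℝ)}

theorem affine_mem_medianSet {K : ℕ} {z : Fin K → ℝ} {x : ℝ} (a b : ℝ) (hx : x ∈ medianSet z) :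
    a + b * x ∈ medianSet (fun k => a + b * z k) := by
  obtain ⟨h₁, h₂⟩ := hx
  rcases le_total 0 b with hb | hb
  · refine ⟨h₁.trans ?_, h₂.trans ?_⟩ <;> norm_cast <;>
      refine card_le_card (monotone_filter_right _ fun k _ hk => ?_) <;>
      exact add_le_add_right (mul_le_mul_of_nonneg_left hk hb) a
  · refine ⟨h₂.trans ?_, h₁.trans ?_⟩ <;> norm_cast <;>
      refine card_le_card (monotone_filter_right _ fun k _ hk => ?_) <;>
      exact add_le_add_right (mul_le_mul_of_nonpos_left hk hb) a

theorem medianSet_nonempty {K : ℕ} (hK : 0 < K) (z : Fin K → ℝ) : (medianSet z).Nonempty := by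
  have hK' : (0 : ℝ) < K := by exact_mod_cast hK
  have : Nonempty (Fin K) := ⟨⟨0, hK⟩⟩
  let S : Finset (Fin K) :=
    univ.filter fun j => (K : ℝ) / 2 ≤ ((univ.filter fun k => z k ≤ z j).card : ℝ)
  have hS : S.Nonempty := by
    obtain ⟨j, -, hj⟩ := exists_max_image univ z univ_nonempty
    refine ⟨j, mem_filter.2 ⟨mem_univ _, ?_⟩⟩
    rw [filter_true_of_mem fun k hk => hj k hk, card_univ, Fintype.card_fin]
    linarith
  obtain ⟨j, hjS, hj⟩ := exists_min_image S z hS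
  refine ⟨z j, (mem_filter.1 hjS).2, ?_⟩
  by_contra! hlt
  have hsum : ((univ.filter fun k => z j ≤ z k).card : ℝ) +
      ((univ.filter fun k => ¬ z j ≤ z k).card : ℝ) = K := by
    have h := card_filter_add_card_filter_not (s := (univ : Finset (Fin K))) fun k => z j ≤ z k
    rw [card_univ, Fintype.card_fin] at h
    exact_mod_cast h
  have hne : (univ.filter fun k => ¬ z j ≤ z k).Nonempty := by
    rw [← card_pos, ← Nat.cast_pos (α := ℝ)]
    linarith
  obtain ⟨l, hl, hmax⟩ := exists_max_image _ z hne
  have hlS : l ∈ S := by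
    refine mem_filter.2 ⟨mem_univ _, ?_⟩
    have hle : ((univ.filter fun k => ¬ z j ≤ z k).card : ℝ) ≤
        ((univ.filter fun k => z k ≤ z l).card : ℝ) := by
      exact_mod_cast card_le_card fun k hk => mem_filter.2 ⟨mem_univ _, hmax k hk⟩
    linarith
  exact (mem_filter.1 hl).2 (hj l hlS)

theorem medianSet_const_subset {K : ℕ} (hK : 0 < K) (a : ℝ) :
    medianSet (fun _ : Fin K => a) ⊆ {a} := by
  have hK' : (0 : ℝ) < K := by exact_mod_cast hK
  rintro y ⟨h₁, h₂⟩
  refine le_antisymm ?_ ?_ <;> by_contra h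
  · simp [h] at h₂
    linarith
  · simp [h] at h₁
    linarith

theorem medianSet_affine {K : ℕ} (hK : 0 < K) (z : Fin K → ℝ) (a b : ℝ) :
    medianSet (fun k => a + b * z k) = (fun x => a + b * x) '' medianSet z := by
  refine Set.Subset.antisymm (fun y hy => ?_) ?_
  · rcases eq_or_ne b 0 with rfl | hb
    · obtain ⟨M, hM⟩ := medianSet_nonempty hK z
      simp only [zero_mul, add_zero] at hy
      exact ⟨M, hM, by simpa using (medianSet_const_subset hK a hy).symm⟩
    · refine ⟨-a / b + b⁻¹ * y, ?_, by field_simp; ring⟩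
      convert affine_mem_medianSet (-a / b) b⁻¹ hy using 2
      funext k
      field_simp
      ring
  · rintro _ ⟨x, hx, rfl⟩
    exact affine_mem_medianSet a b hx

/-- **median-of-means tests for the mean are empirical minimizers.**
For data `Z_1, …, Z_N` split into `K` equal blocks, and `ℓ_m(i) = (Z_i − m)²`, the set of
medians of the block averages of `ℓ_{m'} − ℓ_m` equals
`{(m' − M)² − (m − M)² : M ∈ 𝒬_{1/2}((P_{B_k}Z)_k)}`; in particular, for any fixed
median-of-means `M ∈ 𝒬_{1/2}((P_{B_k}Z)_k)`, the test statistic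
`T_N(m,m') = MOM_K((Z−m')² − (Z−m)²)` decomposes as `ℓ_N(m') − ℓ_N(m)` with
`ℓ_N(m) = (m − M)²`. -/
theorem stmt18 {N K : ℕ} (hN : 0 < N) (Z : Fin N → ℝ)
    (B : Fin K → Finset (Fin N))
    (hcard : ∀ k, (B k).card * K = N)
    (hdisj : ∀ k l, k ≠ l → Disjoint (B k) (B l))
    (hcover : ∀ i, ∃ k, i ∈ B k)
    (m m' : ℝ) :
    medianSet (fun k => ((K : ℝ) / N) * ∑ i ∈ B k, ((Z i - m') ^ 2 - (Z i - m) ^ 2)) =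
      {y : ℝ | ∃ M ∈ medianSet (fun k => ((K : ℝ) / N) * ∑ i ∈ B k, Z i),
        y = (m' - M) ^ 2 - (m - M) ^ 2} ∧
    ∀ M ∈ medianSet (fun k => ((K : ℝ) / N) * ∑ i ∈ B k, Z i),
      (m' - M) ^ 2 - (m - M) ^ 2 ∈
        medianSet (fun k => ((K : ℝ) / N) * ∑ i ∈ B k, ((Z i - m') ^ 2 - (Z i - m) ^ 2)) := by
  have hK : 0 < K := by
    obtain ⟨k, -⟩ := hcover ⟨0, hN⟩
    exact k.pos
  have hblock : (fun k => ((K : ℝ) / N) * ∑ i ∈ B k, ((Z i - m') ^ 2 - (Z i - m) ^ 2)) =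
      fun k => (m' ^ 2 - m ^ 2) + (2 * (m - m')) * (((K : ℝ) / N) * ∑ i ∈ B k, Z i) := by
    funext k
    have hN' : (N : ℝ) ≠ 0 := by exact_mod_cast hN.ne'
    have hone : (K : ℝ) / N * (B k).card = 1 := by
      rw [div_mul_eq_mul_div, div_eq_one_iff_eq hN', mul_comm]
      exact_mod_cast hcard k
    have hsum : ∑ i ∈ B k, ((Z i - m') ^ 2 - (Z i - m) ^ 2) =
        (B k).card * (m' ^ 2 - m ^ 2) + (2 * (m - m')) * ∑ i ∈ B k, Z i := by
      rw [← nsmul_eq_mul, ← sum_const, mul_sum, ← sum_add_distrib]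
      exact sum_congr rfl fun i _ => by ring
    rw [hsum]
    linear_combination (m' ^ 2 - m ^ 2) * hone
  have hdiff : ∀ M : ℝ, (m' - M) ^ 2 - (m - M) ^ 2 = (m' ^ 2 - m ^ 2) + (2 * (m - m')) * M :=
    fun M => by ring
  simp only [hblock, hdiff, medianSet_affine hK]
  exact ⟨Set.ext fun y => exists_congr fun M => and_congr_right fun _ => eq_comm,
    fun M hM => Set.mem_image_of_mem _ hM⟩
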